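/- Let 𝔻 := { z ∈ ℂ : |z| ≤ 1 } be the closed unit disk and let n ≥ 1. For every product probability measure μ on 𝔻^n, every convex 1-Lipschitz function F : ℂ^n → ℝ, every median M(F) of F with respect to μ, and every r ≥ 0: μ( { x ∈ 𝔻^n : |F(x) − M(F)| ≥ r } ) ≤ 4·exp( −r²/16 ). -/

import Mathlib

open MeasureTheory

/-- Maurey's property `(τ)` restricted to convex Lipschitz functions: whenever `u` is dominated by
the exponential of the infimum convolution of `f` with the cost `c`, the product of the integrals
of `u` and `exp (-f)` is at most `1`. -/
def ConvexInfConvIneq {E : Type*} [NormedAddCommGroup E] [NormedSpace ℝ E] [MeasurableSpace E]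
    (μ : Measure E) (c : E → ℝ) : Prop :=
  ∀ (K : NNReal) (f : E → ℝ), LipschitzWith K f → ConvexOn ℝ Set.univ f →
    ∀ u : E → ENNReal, Measurable u →
      (∀ x y, u x ≤ ENNReal.ofReal (Real.exp (f y + c (x - y)))) →
      (∫⁻ x, u x ∂μ) * (∫⁻ x, ENNReal.ofReal (Real.exp (-f x)) ∂μ) ≤ 1

theorem exp_sub_sq_add_exp_neg_le_two {v : ℝ} (hv₀ : 0 ≤ v) (hv : v ≤ 1 / 2) :
    Real.exp (v - v ^ 2) + Real.exp (-v) ≤ 2 := by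
  have hw₀ : 0 ≤ v - v ^ 2 := by nlinarith
  have hwv : v - v ^ 2 ≤ v := by nlinarith
  have h₁ := Real.exp_bound (x := v - v ^ 2) (by rw [abs_of_nonneg hw₀]; linarith)
    (n := 3) (by norm_num)
  have h₂ := Real.exp_bound (x := -v) (by rw [abs_neg, abs_of_nonneg hv₀]; linarith)
    (n := 3) (by norm_num)
  rw [abs_of_nonneg hw₀] at h₁
  rw [abs_neg, abs_of_nonneg hv₀] at h₂
  have h₁' := (abs_le.1 h₁).2
  have h₂' := (abs_le.1 h₂).2
  norm_num [Finset.sum_range_succ, Nat.factorial] at h₁' h₂'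
  have hw₃ : (v - v ^ 2) ^ 3 ≤ v ^ 3 := by gcongr
  have hv₃ : 0 ≤ v ^ 3 := by positivity
  have hv₄ : v ^ 3 * v ≤ v ^ 3 * (1 / 2) := by gcongr
  nlinarith

/-- The one-point estimate behind property `(τ)`, with an explicit interpolation parameter. -/
theorem exists_interpolation_exp_le {v : ℝ} (hv : 0 ≤ v) :
    ∃ θ : ℝ, 0 ≤ θ ∧ θ ≤ 1 ∧
      Real.exp (v - θ * v + θ ^ 2 / 4) + Real.exp (-v) ≤ 2 := by
  rcases le_total v (1 / 2) with h | h
  · refine ⟨2 * v, by linarith, by linarith, ?_⟩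
    convert exp_sub_sq_add_exp_neg_le_two hv h using 3
    ring
  · refine ⟨1, by norm_num, le_rfl, ?_⟩
    have h₁ := exp_sub_sq_add_exp_neg_le_two (v := 1 / 2) (by norm_num) le_rfl
    have h₂ : Real.exp (-v) ≤ Real.exp (-(1 / 2)) := Real.exp_le_exp.2 (by linarith)
    have h₃ : v - 1 * v + 1 ^ 2 / 4 = 1 / 2 - (1 / 2) ^ 2 := by ring
    rw [h₃]
    linarith

theorem mul_le_one_of_add_sq_mul_le {A B : ENNReal} {s : ℝ} (hs : 0 < s)
    (h : A + ENNReal.ofReal (s ^ 2) * B ≤ ENNReal.ofReal (2 * s)) : A * B ≤ 1 := by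
  have hA : A ≠ ⊤ := ne_top_of_le_ne_top ENNReal.ofReal_ne_top (le_self_add.trans h)
  have hsB : ENNReal.ofReal (s ^ 2) * B ≠ ⊤ :=
    ne_top_of_le_ne_top ENNReal.ofReal_ne_top (le_add_self.trans h)
  have hB : B ≠ ⊤ := by
    rintro rfl
    exact hsB (ENNReal.mul_top (by simpa using hs.ne'))
  lift A to NNReal using hA
  lift B to NNReal using hB
  have h' := ENNReal.toReal_mono ENNReal.ofReal_ne_top h
  rw [ENNReal.toReal_add (by simp) hsB, ENNReal.toReal_mul,
    ENNReal.toReal_ofReal (by positivity), ENNReal.toReal_ofReal (by positivity)] at h'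
  simp only [ENNReal.coe_toReal] at h'
  have hAB : (A : ℝ) * B ≤ 1 := by
    nlinarith [sq_nonneg (s * (B : ℝ) - 1), mul_le_mul_of_nonneg_right h' B.coe_nonneg]
  exact_mod_cast hAB

theorem convexInfConvIneq_of_unitDisk (μ : Measure ℂ) [IsProbabilityMeasure μ]
    (hμ : ∀ᵐ z ∂μ, ‖z‖ ≤ 1) : ConvexInfConvIneq μ (fun z => ‖z‖ ^ 2 / 16) := by
  intro K f hf hconv u hu hle
  obtain ⟨x₀, hx₀, hmin⟩ := (isCompact_closedBall (0 : ℂ) 1).exists_isMinOn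
    ⟨0, by simp⟩ hf.continuous.continuousOn
  have hx₀' : ‖x₀‖ ≤ 1 := by simpa using hx₀
  have hpt : ∀ᵐ x ∂μ, u x + ENNReal.ofReal (Real.exp (f x₀) ^ 2) *
      ENNReal.ofReal (Real.exp (-f x)) ≤ ENNReal.ofReal (2 * Real.exp (f x₀)) := by
    filter_upwards [hμ] with x hx
    have hv : 0 ≤ f x - f x₀ := sub_nonneg.2 (hmin (by simpa using hx))
    obtain ⟨θ, hθ₀, hθ₁, hθ⟩ := exists_interpolation_exp_le hv
    have hfy := hconv.2 (Set.mem_univ x) (Set.mem_univ x₀) (sub_nonneg.2 hθ₁) hθ₀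
      (sub_add_cancel 1 θ)
    simp only [smul_eq_mul] at hfy
    have hdist : ‖x - ((1 - θ) • x + θ • x₀)‖ ≤ θ * 2 := by
      have : x - ((1 - θ) • x + θ • x₀) = θ • (x - x₀) := by module
      rw [this, norm_smul, Real.norm_of_nonneg hθ₀]
      gcongr
      linarith [norm_sub_le x x₀]
    have hdist₂ : ‖x - ((1 - θ) • x + θ • x₀)‖ ^ 2 ≤ (θ * 2) ^ 2 := by gcongr
    have hu' : u x ≤ ENNReal.ofReal (Real.exp (f x₀) *
        Real.exp ((f x - f x₀) - θ * (f x - f x₀) + θ ^ 2 / 4)) := by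
      refine (hle x ((1 - θ) • x + θ • x₀)).trans (ENNReal.ofReal_le_ofReal ?_)
      rw [← Real.exp_add]
      apply Real.exp_le_exp.2
      nlinarith
    have hexp : Real.exp (f x₀) ^ 2 * Real.exp (-f x) =
        Real.exp (f x₀) * Real.exp (-(f x - f x₀)) := by
      rw [sq, mul_assoc, ← Real.exp_add]
      ring_nf
    rw [← ENNReal.ofReal_mul (by positivity), hexp]
    refine (add_le_add_left hu' _).trans ?_
    rw [← ENNReal.ofReal_add (by positivity) (by positivity)]
    apply ENNReal.ofReal_le_ofReal
    nlinarith [Real.exp_pos (f x₀)]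
  apply mul_le_one_of_add_sq_mul_le (Real.exp_pos (f x₀))
  have hmeas : Measurable fun x => ENNReal.ofReal (Real.exp (-f x)) :=
    (Real.continuous_exp.comp hf.continuous.neg).measurable.ennreal_ofReal
  rw [← lintegral_const_mul _ hmeas, ← lintegral_add_left hu]
  exact (lintegral_mono_ae hpt).trans (by simp)

theorem integrable_of_continuous_of_unitDisk {μ : Measure ℂ} [IsProbabilityMeasure μ]
    (hμ : ∀ᵐ z ∂μ, ‖z‖ ≤ 1) {g : ℂ → ℝ} (hg : Continuous g) : Integrable g μ := by
  have h := hg.continuousOn.integrableOn_compact (μ := μ) (isCompact_closedBall (0 : ℂ) 1)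
  rwa [IntegrableOn, Measure.restrict_eq_self_of_ae_mem] at h
  simpa using hμ

section LogIntegralExp

variable {E : Type*} [NormedAddCommGroup E] {μ : Measure ℂ}
  [IsProbabilityMeasure μ]

theorem exp_log_integral_exp (hμ : ∀ᵐ z ∂μ, ‖z‖ ≤ 1) {g : ℂ → ℝ} (hg : Continuous g) :
    Real.exp (Real.log (∫ x, Real.exp (g x) ∂μ)) = ∫ x, Real.exp (g x) ∂μ :=
  Real.exp_log (integral_exp_pos (integrable_of_continuous_of_unitDisk hμ
    (Real.continuous_exp.comp hg)))

theorem lipschitzWith_log_integral_exp (hμ : ∀ᵐ z ∂μ, ‖z‖ ≤ 1) {K : NNReal} {h : ℂ × E → ℝ}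
    (hh : LipschitzWith K h) :
    LipschitzWith K fun y => Real.log (∫ x, Real.exp (h (x, y)) ∂μ) := by
  have hc (y : E) : Continuous fun x => h (x, y) := hh.continuous.comp (by fun_prop)
  have hi (y : E) := integrable_of_continuous_of_unitDisk hμ (Real.continuous_exp.comp (hc y))
  refine LipschitzWith.of_le_add_mul K fun y z => ?_
  rw [← Real.exp_le_exp, Real.exp_add, exp_log_integral_exp hμ (hc y),
    exp_log_integral_exp hμ (hc z), ← integral_mul_const]
  refine integral_mono (hi y) ((hi z).mul_const _) fun x => ?_
  change Real.exp _ ≤ Real.exp _ * Real.exp _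
  rw [← Real.exp_add, Real.exp_le_exp]
  have := hh.le_add_mul (x, y) (x, z)
  simpa [Prod.dist_eq] using this

theorem convexOn_log_integral_exp [NormedSpace ℝ E] (hμ : ∀ᵐ z ∂μ, ‖z‖ ≤ 1) {h : ℂ × E → ℝ}
    (hc : Continuous h) (hh : ConvexOn ℝ Set.univ h) :
    ConvexOn ℝ Set.univ fun y => Real.log (∫ x, Real.exp (h (x, y)) ∂μ) := by
  have hcy (y : E) : Continuous fun x => h (x, y) := hc.comp (by fun_prop)
  have hi (y : E) := integrable_of_continuous_of_unitDisk hμ (Real.continuous_exp.comp (hcy y))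
  refine ⟨convex_univ, fun y _ z _ a b ha hb hab => ?_⟩
  simp only [smul_eq_mul]
  set φ := fun y => Real.log (∫ x, Real.exp (h (x, y)) ∂μ) with hφ
  have hnorm (y : E) : ∫ x, Real.exp (h (x, y)) * Real.exp (-φ y) ∂μ = 1 := by
    rw [integral_mul_const, ← exp_log_integral_exp hμ (hcy y), ← Real.exp_add]
    simp [hφ]
  have hie (y : E) : Integrable (fun x => Real.exp (h (x, y)) * Real.exp (-φ y)) μ :=
    (hi y).mul_const _
  have hint : ∫ x, Real.exp (h (x, a • y + b • z)) * Real.exp (-(a * φ y + b * φ z)) ∂μ ≤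
      ∫ x, (a * (Real.exp (h (x, y)) * Real.exp (-φ y)) +
        b * (Real.exp (h (x, z)) * Real.exp (-φ z))) ∂μ := by
    refine integral_mono ((hi _).mul_const _)
      (((hie y).const_mul a).add ((hie z).const_mul b)) fun x => ?_
    change Real.exp _ * Real.exp _ ≤ _
    simp only [← Real.exp_add]
    have h₁ := hh.2 (Set.mem_univ (x, y)) (Set.mem_univ (x, z)) ha hb hab
    have hpair : a • (x, y) + b • (x, z) = (x, a • y + b • z) := by
      ext1
      · change a • x + b • x = x
        rw [← add_smul, hab, one_smul]
      · rfl
    rw [hpair] at h₁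
    simp only [smul_eq_mul] at h₁
    have h₂ := convexOn_exp.2 (Set.mem_univ (h (x, y) + -φ y))
      (Set.mem_univ (h (x, z) + -φ z)) ha hb hab
    simp only [smul_eq_mul] at h₂
    refine le_trans (Real.exp_le_exp.2 ?_) h₂
    linarith
  rw [integral_add ((hie y).const_mul a) ((hie z).const_mul b),
    integral_const_mul, integral_const_mul, hnorm, hnorm, mul_one, mul_one, hab,
    integral_mul_const, ← exp_log_integral_exp hμ (hcy _), ← Real.exp_add,
    Real.exp_le_one_iff] at hint
  linarith

end LogIntegralExp

section PartialInfConv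

variable {E : Type*} [NormedAddCommGroup E]

/-- Infimum convolution with the quadratic cost in the first variable only. -/
noncomputable def partialInfConv (f : ℂ × E → ℝ) (p : ℂ × E) : ℝ :=
  ⨅ w : ℂ, (f (p - (w, 0)) + ‖w‖ ^ 2 / 16)

variable {K : NNReal} {f : ℂ × E → ℝ}

theorem partialInfConv_le (hf : LipschitzWith K f) (p : ℂ × E) (w : ℂ) :
    partialInfConv f p ≤ f (p - (w, 0)) + ‖w‖ ^ 2 / 16 := by
  refine ciInf_le ⟨f p - 4 * (K : ℝ) ^ 2, ?_⟩ w
  rintro _ ⟨w, rfl⟩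
  have h := hf.le_add_mul p (p - (w, 0))
  rw [dist_eq_norm, sub_sub_cancel, Prod.norm_mk, norm_zero, max_eq_left (norm_nonneg _)] at h
  change _ ≤ f (p - (w, 0)) + ‖w‖ ^ 2 / 16
  nlinarith [sq_nonneg (‖w‖ - 8 * (K : ℝ))]

theorem lipschitzWith_partialInfConv (hf : LipschitzWith K f) :
    LipschitzWith K (partialInfConv f) := by
  refine LipschitzWith.of_le_add_mul K fun p q => ?_
  rw [← sub_le_iff_le_add]
  refine le_ciInf fun w => ?_
  have h₁ := partialInfConv_le hf p w
  have h₂ := hf.le_add_mul (p - (w, 0)) (q - (w, 0))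
  rw [dist_sub_right] at h₂
  linarith

theorem convexOn_partialInfConv [NormedSpace ℝ E] (hf : LipschitzWith K f)
    (hconv : ConvexOn ℝ Set.univ f) :
    ConvexOn ℝ Set.univ (partialInfConv f) := by
  refine ⟨convex_univ, fun p _ q _ a b ha hb hab => ?_⟩
  refine le_of_forall_pos_le_add fun ε hε => ?_
  obtain ⟨w, hw⟩ := exists_lt_of_ciInf_lt (lt_add_of_pos_right (partialInfConv f p) hε)
  obtain ⟨z, hz⟩ := exists_lt_of_ciInf_lt (lt_add_of_pos_right (partialInfConv f q) hε)
  have h₁ := partialInfConv_le hf (a • p + b • q) (a • w + b • z)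
  have h₂ := hconv.2 (Set.mem_univ (p - (w, 0))) (Set.mem_univ (q - (z, 0))) ha hb hab
  have hpair : a • (p - (w, (0 : E))) + b • (q - (z, 0)) =
      a • p + b • q - (a • w + b • z, 0) := by
    ext1
    · simp; ring
    · simp
  rw [hpair] at h₂
  have h₃ := ((convexOn_univ_norm (E := ℂ)).pow (fun _ _ => norm_nonneg _) 2).2
    (Set.mem_univ w) (Set.mem_univ z) ha hb hab
  simp only [smul_eq_mul, Pi.pow_apply] at h₁ h₂ h₃ ⊢
  have h₄ := mul_le_mul_of_nonneg_left hw.le ha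
  have h₅ := mul_le_mul_of_nonneg_left hz.le hb
  have h₆ : a * ε + b * ε = ε := by rw [← add_mul, hab, one_mul]
  linarith

end PartialInfConv

theorem ConvexInfConvIneq.prod_unitDisk {E : Type*} [NormedAddCommGroup E] [NormedSpace ℝ E]
    [MeasurableSpace E] [BorelSpace E] [SecondCountableTopology E] {μ : Measure ℂ}
    [IsProbabilityMeasure μ] (hμ : ∀ᵐ z ∂μ, ‖z‖ ≤ 1) {ν : Measure E} [SFinite ν] {c : E → ℝ}
    (hν : ConvexInfConvIneq ν c) :
    ConvexInfConvIneq (μ.prod ν) (fun p => ‖p.1‖ ^ 2 / 16 + c p.2) := by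
  intro K f hf hconv u hu hle
  set h := partialInfConv f
  have hhL : LipschitzWith K h := lipschitzWith_partialInfConv hf
  have hhc (y : E) : Continuous fun x => h (x, y) := hhL.continuous.comp (by fun_prop)
  set φ : E → ℝ := fun y => Real.log (∫ x, Real.exp (h (x, y)) ∂μ) with hφ
  have hexpφ (y : E) : ENNReal.ofReal (Real.exp (φ y)) =
      ∫⁻ x, ENNReal.ofReal (Real.exp (h (x, y))) ∂μ := by
    rw [hφ]
    simp only
    rw [exp_log_integral_exp hμ (hhc y)]
    exact ofReal_integral_eq_lintegral_ofReal
      (integrable_of_continuous_of_unitDisk hμ (Real.continuous_exp.comp (hhc y)))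
      (.of_forall fun _ => (Real.exp_pos _).le)
  have hmeas (y : E) : Measurable fun x => ENNReal.ofReal (Real.exp (h (x, y))) :=
    (Real.continuous_exp.comp (hhc y)).measurable.ennreal_ofReal
  have hfm : Measurable fun p => ENNReal.ofReal (Real.exp (-f p)) :=
    (Real.continuous_exp.comp hf.continuous.neg).measurable.ennreal_ofReal
  have key := hν K φ (lipschitzWith_log_integral_exp hμ hhL)
    (convexOn_log_integral_exp hμ hhL.continuous (convexOn_partialInfConv hf hconv))
    (fun y => ∫⁻ x, u (x, y) ∂μ) hu.lintegral_prod_left' (fun y z => by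
      rw [Real.exp_add, ENNReal.ofReal_mul (Real.exp_pos _).le, hexpφ,
        ← lintegral_mul_const _ (hmeas z)]
      refine lintegral_mono fun x => ?_
      rw [← ENNReal.ofReal_mul (Real.exp_pos _).le, ← Real.exp_add]
      have hbound : ∀ w : ℂ, u (x, y) ≤ ENNReal.ofReal (Real.exp
          ((f ((x, z) - (w, 0)) + ‖w‖ ^ 2 / 16) + c (y - z))) := fun w => by
        refine (hle (x, y) ((x, z) - (w, 0))).trans (le_of_eq ?_)
        congr 2
        simp
        ring
      rcases eq_or_ne (u (x, y)) 0 with h0 | h0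
      · simp [h0]
      have htop : u (x, y) ≠ ⊤ := ne_top_of_le_ne_top ENNReal.ofReal_ne_top (hbound 0)
      have hpos : 0 < (u (x, y)).toReal := ENNReal.toReal_pos h0 htop
      rw [← ENNReal.ofReal_toReal htop]
      apply ENNReal.ofReal_le_ofReal
      rw [← Real.log_le_iff_le_exp hpos, ← sub_le_iff_le_add]
      refine le_ciInf fun w => ?_
      rw [sub_le_iff_le_add, Real.log_le_iff_le_exp hpos]
      exact ENNReal.toReal_le_of_le_ofReal (Real.exp_pos _).le (hbound w))
  rw [lintegral_prod_symm _ hu.aemeasurable, lintegral_prod_symm _ hfm.aemeasurable]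
  refine le_trans (mul_le_mul_right (lintegral_mono fun y => ?_) _) key
  have hone := convexInfConvIneq_of_unitDisk μ hμ K (fun x => f (x, y))
    (by simpa [Function.comp_def] using hf.comp (LipschitzWith.prodMk_right y))
    ⟨convex_univ, fun x _ x' _ a b ha hb hab => by
      have := hconv.2 (Set.mem_univ (x, y)) (Set.mem_univ (x', y)) ha hb hab
      have hpair : a • (x, y) + b • (x', y) = (a • x + b • x', y) := by
        ext1
        · rfl
        · change a • y + b • y = y
          rw [← add_smul, hab, one_smul]
      rwa [hpair] at this⟩
    (fun x => ENNReal.ofReal (Real.exp (h (x, y)))) (hmeas y) (fun x x' => by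
      apply ENNReal.ofReal_le_ofReal
      apply Real.exp_le_exp.2
      simpa using partialInfConv_le hf (x, y) (x - x'))
  rw [← hexpφ, mul_comm] at hone
  rw [Real.exp_neg, ENNReal.ofReal_inv_of_pos (Real.exp_pos _)]
  exact ENNReal.le_inv_iff_mul_le.2 hone

theorem convexInfConvIneq_pi (n : ℕ) (μ : Fin n → Measure ℂ)
    [∀ i, IsProbabilityMeasure (μ i)] (hμ : ∀ i, ∀ᵐ z ∂μ i, ‖z‖ ≤ 1) :
    ConvexInfConvIneq (Measure.pi μ) (fun x => ∑ i, ‖x i‖ ^ 2 / 16) := by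
  induction n with
  | zero =>
    intro K f _ _ u _ hle
    have h₁ : ∀ x, u x ≤ ENNReal.ofReal (Real.exp (f 0)) := fun x => by simpa using hle x 0
    have h₂ : ∀ x, f x = f 0 := fun x => by rw [Subsingleton.elim x 0]
    simp only [h₂, lintegral_const, measure_univ, mul_one]
    refine (mul_le_mul_left (lintegral_mono h₁) _).trans ?_
    simp [← ENNReal.ofReal_mul (Real.exp_pos _).le, ← Real.exp_add]
  | succ n ih =>
    intro K f hf hconv u hu hle
    have hmp := (measurePreserving_piFinSuccAbove μ 0).symm
    have hprod := (ih (fun i => μ i.succ) (fun i => hμ i.succ)).prod_unitDisk (hμ 0)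
    rw [← hmp.lintegral_comp_emb (MeasurableEquiv.measurableEmbedding _),
      ← hmp.lintegral_comp_emb (MeasurableEquiv.measurableEmbedding _)]
    have hcons : ∀ p : ℂ × (Fin n → ℂ),
        (MeasurableEquiv.piFinSuccAbove (fun _ : Fin (n + 1) => ℂ) 0).symm p =
          Fin.cons p.1 p.2 := fun p => by
      simp [MeasurableEquiv.piFinSuccAbove, Fin.consEquiv]
    refine hprod K (fun p => f ((MeasurableEquiv.piFinSuccAbove (fun _ => ℂ) 0).symm p))
      ?_ ?_ _ (hu.comp (MeasurableEquiv.measurable _)) fun p q => ?_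
    · refine LipschitzWith.of_le_add_mul K fun p q =>
        (hf.le_add_mul _ ((MeasurableEquiv.piFinSuccAbove (fun _ => ℂ) 0).symm q)).trans ?_
      gcongr
      refine (dist_pi_le_iff dist_nonneg).2 fun i => ?_
      rw [hcons, hcons]
      refine Fin.cases ?_ (fun j => ?_) i
      · exact le_max_left _ _
      · exact (dist_le_pi_dist p.2 q.2 j).trans (le_max_right _ _)
    · refine ⟨convex_univ, fun p _ q _ a b ha hb hab => ?_⟩
      refine le_of_eq_of_le (congrArg f ?_)
        (hconv.2 (Set.mem_univ _) (Set.mem_univ _) ha hb hab)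
      ext i
      simp only [hcons]
      refine Fin.cases ?_ (fun j => ?_) i <;> simp
    · refine (hle _ ((MeasurableEquiv.piFinSuccAbove (fun _ => ℂ) 0).symm q)).trans
        (le_of_eq ?_)
      simp [hcons, Fin.sum_univ_succ]

theorem le_ofReal_two_mul_exp {p q A B : ENNReal} {a b : ℝ} (hp : p ≠ ⊤)
    (hq : 1 / 2 ≤ q) (hA : ENNReal.ofReal (Real.exp a) * p ≤ A)
    (hB : ENNReal.ofReal (Real.exp b) * q ≤ B) (hAB : A * B ≤ 1) :
    p ≤ ENNReal.ofReal (2 * Real.exp (-(a + b))) := by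
  have h : ENNReal.ofReal (Real.exp a) * p * (ENNReal.ofReal (Real.exp b) * (1 / 2)) ≤ 1 :=
    (mul_le_mul' hA ((mul_le_mul_right hq _).trans hB)).trans hAB
  lift p to NNReal using hp
  have h' := ENNReal.toReal_mono ENNReal.one_ne_top h
  simp only [ENNReal.toReal_mul, ENNReal.toReal_ofReal (Real.exp_pos _).le,
    ENNReal.coe_toReal, ENNReal.toReal_div, ENNReal.toReal_one, ENNReal.toReal_ofNat] at h'
  rw [← ENNReal.ofReal_coe_nnreal]
  apply ENNReal.ofReal_le_ofReal
  rw [Real.exp_neg, Real.exp_add, ← div_eq_mul_inv, le_div_iff₀ (by positivity)]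
  linarith

/-- Talagrand-type concentration inequality on the polydisk: for every product probability
measure `μ = μ₁ × … × μ_n` on `𝔻^n` (each `μᵢ` a probability measure on ℂ supported on the
closed unit disk), every convex `1`-Lipschitz (for the Euclidean norm on `ℂ^n ≅ ℝ^{2n}`)
function `F : ℂ^n → ℝ`, every median `m` of `F`, and every `r ≥ 0`,
`μ(x ∈ 𝔻^n : |F(x) − m| ≥ r) ≤ 4 exp(−r²/16)`. -/
theorem talagrand_polydisk (n : ℕ) (hn : 1 ≤ n) (μi : Fin n → Measure ℂ)
    (hprob : ∀ i, IsProbabilityMeasure (μi i))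
    (hsupp : ∀ i, μi i {z : ℂ | 1 < ‖z‖} = 0)
    (F : (Fin n → ℂ) → ℝ) (hconv : ConvexOn ℝ Set.univ F)
    (hlip : ∀ x y : Fin n → ℂ, |F x - F y| ≤ Real.sqrt (∑ i, ‖x i - y i‖ ^ 2))
    (m : ℝ)
    (hmed₁ : 1 / 2 ≤ Measure.pi μi {x | m ≤ F x})
    (hmed₂ : 1 / 2 ≤ Measure.pi μi {x | F x ≤ m})
    (r : ℝ) (hr : 0 ≤ r) :
    Measure.pi μi {x | (∀ i, ‖x i‖ ≤ 1) ∧ r ≤ |F x - m|} ≤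
      ENNReal.ofReal (4 * Real.exp (-r ^ 2 / 16)) := by
  have hae : ∀ i, ∀ᵐ z ∂μi i, ‖z‖ ≤ 1 := fun i => by
    rw [ae_iff]
    simpa only [not_le] using hsupp i
  have hF : LipschitzWith (NNReal.sqrt n) F := by
    refine LipschitzWith.of_dist_le_mul fun x y => (hlip x y).trans ?_
    have hsum : ∑ i, ‖x i - y i‖ ^ 2 ≤ n * dist x y ^ 2 := by
      have : ∀ i ∈ Finset.univ, ‖x i - y i‖ ^ 2 ≤ dist x y ^ 2 := fun i _ => by
        rw [← dist_eq_norm]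
        gcongr
        exact dist_le_pi_dist x y i
      simpa using Finset.sum_le_card_nsmul _ _ _ this
    refine (Real.sqrt_le_sqrt hsum).trans (le_of_eq ?_)
    rw [Real.sqrt_mul (Nat.cast_nonneg n), Real.sqrt_sq dist_nonneg]
    simp
  have hFc := hF.continuous
  set t : ℝ := r / 8 with ht
  have ht₀ : 0 ≤ t := by positivity
  have hA : Measurable fun x => ENNReal.ofReal (Real.exp (t * F x - 4 * t ^ 2)) :=
    Continuous.measurable (by fun_prop) |>.ennreal_ofReal
  have hB : Measurable fun x => ENNReal.ofReal (Real.exp (-(t * F x))) :=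
    Continuous.measurable (by fun_prop) |>.ennreal_ofReal
  have key := convexInfConvIneq_pi n μi hae (‖t‖₊ * NNReal.sqrt n) (fun x => t * F x)
    ((lipschitzWith_smul t).comp hF) (hconv.smul ht₀)
    (fun x => ENNReal.ofReal (Real.exp (t * F x - 4 * t ^ 2))) hA (fun x y => by
      apply ENNReal.ofReal_le_ofReal
      apply Real.exp_le_exp.2
      simp only [Pi.sub_apply, ← Finset.sum_div]
      have h₁ := (le_abs_self _).trans (hlip x y)
      have h₂ := Real.sq_sqrt (show 0 ≤ ∑ i, ‖x i - y i‖ ^ 2 by positivity)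
      nlinarith [mul_le_mul_of_nonneg_left h₁ ht₀,
        sq_nonneg (Real.sqrt (∑ i, ‖x i - y i‖ ^ 2) - 8 * t)])
  have markovA (s : ℝ) : ENNReal.ofReal (Real.exp (t * s - 4 * t ^ 2)) *
      Measure.pi μi {x | s ≤ F x} ≤
        ∫⁻ x, ENNReal.ofReal (Real.exp (t * F x - 4 * t ^ 2)) ∂Measure.pi μi := by
    refine le_trans (mul_le_mul_right (measure_mono fun x (hx : s ≤ F x) => ?_) _)
      (mul_meas_ge_le_lintegral hA _)
    exact ENNReal.ofReal_le_ofReal (Real.exp_le_exp.2 (by gcongr))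
  have markovB (s : ℝ) : ENNReal.ofReal (Real.exp (-(t * s))) *
      Measure.pi μi {x | F x ≤ s} ≤
        ∫⁻ x, ENNReal.ofReal (Real.exp (-(t * F x))) ∂Measure.pi μi := by
    refine le_trans (mul_le_mul_right (measure_mono fun x (hx : F x ≤ s) => ?_) _)
      (mul_meas_ge_le_lintegral hB _)
    exact ENNReal.ofReal_le_ofReal (Real.exp_le_exp.2 (by gcongr))
  have upper := le_ofReal_two_mul_exp (measure_ne_top _ _) hmed₂ (markovA (m + r)) (markovB m) key
  have lower := le_ofReal_two_mul_exp (measure_ne_top _ _) hmed₁ (markovB (m - r)) (markovA m)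
    (by rwa [mul_comm])
  have hsub : {x : Fin n → ℂ | (∀ i, ‖x i‖ ≤ 1) ∧ r ≤ |F x - m|} ⊆
      {x | m + r ≤ F x} ∪ {x | F x ≤ m - r} := by
    rintro x ⟨-, hx⟩
    rcases le_abs.1 hx with h | h
    · exact Or.inl (show m + r ≤ F x by linarith)
    · exact Or.inr (show F x ≤ m - r by linarith)
  refine (measure_mono hsub).trans ((measure_union_le _ _).trans
    ((add_le_add upper lower).trans (le_of_eq ?_)))
  rw [← ENNReal.ofReal_add (by positivity) (by positivity)]
  have e₁ : -(t * (m + r) - 4 * t ^ 2 + -(t * m)) = -r ^ 2 / 16 := by rw [ht]; ring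
  have e₂ : -(-(t * (m - r)) + (t * m - 4 * t ^ 2)) = -r ^ 2 / 16 := by rw [ht]; ring
  rw [e₁, e₂]
  ring_nf
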